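/- Suppose the noise radii are homogeneous: a_t = a ≥ 0 for all t, and let Δ = ⌈(T+1)/(K+1)⌉. Then the optimal cost of the remote estimation problem, min over all pairs (f, g) of J(f, g), equals a·(|λ|^{Δ−1} − 1)/(|λ| − 1) when |λ| ≠ 1, and equals (Δ − 1)·a when |λ| = 1. -/

import Mathlib

open scoped ENNReal

noncomputable section

abbrev Euc (n : ℕ) := EuclideanSpace ℝ (Fin n)

variable {n : ℕ}

/-- Source trajectory: `X_1 = n_1`, `X_{t+1} = λ A X_t + n_{t+1}` (0-indexed). -/
def srcX (lam : ℝ) (A : Euc n ≃ₗᵢ[ℝ] Euc n) (ν : ℕ → Euc n) : ℕ → Euc n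
  | 0 => ν 0
  | t + 1 => lam • A (srcX lam A ν t) + ν (t + 1)

/-- Admissible noise sequences: `‖n_t‖ ≤ a_t` throughout the horizon. -/
def Noise (n : ℕ) (T : ℕ) (a : ℕ → ℝ) : Set (ℕ → Euc n) := {ν | ∀ t < T, ‖ν t‖ ≤ a t}

/-- A transmission strategy, encoded by the transmission decisions it induces on
noise realizations.  `adapted` says the decision at time `t` is a function of the
information `(X_{1:t}, E_{1:t}, Y_{1:t-1})` available to the sensor (equivalently,
since the energy levels and channel outputs are themselves determined by `X_{1:t}`
and the strategy, a function of `X_{1:t}`); `energy_ok` says a transmission can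
occur only when the remaining energy `E_t = K − Σ_{i<t} U_i` is positive. -/
structure TxStrategy (lam : ℝ) (A : Euc n ≃ₗᵢ[ℝ] Euc n) (T K : ℕ) where
  U : (ℕ → Euc n) → ℕ → Bool
  energy_ok : ∀ ν t, t < T → U ν t = true →
    (∑ i ∈ Finset.range t, (if U ν i then 1 else 0)) < K
  adapted : ∀ ν ν' t, t < T →
    (∀ i ≤ t, srcX lam A ν i = srcX lam A ν' i) → U ν t = U ν' t

/-- Channel output: `Y_t = X_t` if `U_t = 1`, and `Y_t = ε` (i.e. `none`) otherwise. -/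
def chOut (lam : ℝ) (A : Euc n ≃ₗᵢ[ℝ] Euc n) (U : (ℕ → Euc n) → ℕ → Bool)
    (ν : ℕ → Euc n) (t : ℕ) : Option (Euc n) :=
  if U ν t then some (srcX lam A ν t) else none

/-- An estimation strategy: `X̂_t = g_t(Y_{1:t})`. -/
def EstStrategy (n : ℕ) : Type := (t : ℕ) → (Fin (t + 1) → Option (Euc n)) → Euc n

/-- Worst-case maximum instantaneous estimation error
`J(f, g) = sup_{noise} max_{1≤t≤T} ‖X_t − X̂_t‖` (valued in `ℝ≥0∞`). -/
def Jcost (lam : ℝ) (A : Euc n ≃ₗᵢ[ℝ] Euc n) (T K : ℕ) (a : ℕ → ℝ)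
    (f : TxStrategy lam A T K) (g : EstStrategy n) : ℝ≥0∞ :=
  ⨆ ν ∈ Noise n T a, ⨆ t : Fin T,
    ENNReal.ofReal ‖srcX lam A ν t - g t (fun i => chOut lam A f.U ν i)‖


/-- `Δ = ⌈(T+1)/(K+1)⌉`. -/
def DeltaOf (T K : ℕ) : ℕ := ⌈((T : ℚ) + 1) / ((K : ℚ) + 1)⌉₊

/-- The worst-case error after `m` steps without transmission, `a (1 + |λ| + ⋯ + |λ|^(m-1))`. -/
def silentError (lam a : ℝ) (m : ℕ) : ℝ := a * ∑ i ∈ Finset.range m, |lam| ^ i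

lemma silentError_zero (lam a : ℝ) : silentError lam a 0 = 0 := by simp [silentError]

lemma silentError_succ (lam a : ℝ) (m : ℕ) :
    silentError lam a (m + 1) = |lam| * silentError lam a m + a := by
  simp only [silentError, geom_sum_succ]
  ring

lemma silentError_mono (lam : ℝ) {a : ℝ} (ha : 0 ≤ a) : Monotone (silentError lam a) :=
  monotone_nat_of_le_succ fun m => by
    simp only [silentError, Finset.sum_range_succ]
    exact mul_le_mul_of_nonneg_left (le_add_of_nonneg_right (by positivity)) ha

lemma DeltaOf_pos (T K : ℕ) : 0 < DeltaOf T K := Nat.ceil_pos.2 (by positivity)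

lemma lt_mul_DeltaOf (T K : ℕ) : T < (K + 1) * DeltaOf T K := by
  have h : ((T : ℚ) + 1) / (K + 1) ≤ DeltaOf T K := Nat.le_ceil _
  rw [div_le_iff₀ (by positivity)] at h
  have h' : T + 1 ≤ DeltaOf T K * (K + 1) := by exact_mod_cast h
  linarith

lemma mul_DeltaOf_sub_one_le (T K : ℕ) : (K + 1) * (DeltaOf T K - 1) ≤ T := by
  have hlt : DeltaOf T K - 1 < DeltaOf T K := Nat.sub_lt (DeltaOf_pos T K) one_pos
  have h : ((DeltaOf T K - 1 : ℕ) : ℚ) < ((T : ℚ) + 1) / (K + 1) := Nat.lt_ceil.1 hlt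
  rw [lt_div_iff₀ (by positivity)] at h
  have h' : (DeltaOf T K - 1) * (K + 1) < T + 1 := by exact_mod_cast h
  linarith

lemma sum_range_dvd_succ (d t : ℕ) :
    (∑ i ∈ Finset.range t, if d ∣ i + 1 then 1 else 0) = t / d := by
  induction t with
  | zero => simp
  | succ t ih => rw [Finset.sum_range_succ, ih, Nat.succ_div]

/-- Transmit exactly at the (1-indexed) times divisible by `d`. -/
def periodicTx (lam : ℝ) (A : Euc n ≃ₗᵢ[ℝ] Euc n) {T K d : ℕ} (h : T < (K + 1) * d) :
    TxStrategy lam A T K where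
  U _ t := decide (d ∣ t + 1)
  energy_ok ν t ht hU := by
    simp only [decide_eq_true_eq] at hU ⊢
    rw [sum_range_dvd_succ]
    obtain ⟨q, hq⟩ := hU
    have hd : 0 < d := Nat.pos_of_ne_zero (by rintro rfl; simp at h)
    have hqK : q < K + 1 := by
      by_contra! hc
      have := Nat.mul_le_mul_right d hc
      rw [mul_comm q d] at this
      omega
    have : t / d < q := by
      rw [Nat.div_lt_iff_lt_mul hd, mul_comm]
      omega
    omega
  adapted _ _ _ _ _ := rfl

/-- Predict the source from the last received value by running the noiseless dynamics. -/
def predictor (lam : ℝ) (A : Euc n ≃ₗᵢ[ℝ] Euc n) : EstStrategy n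
  | 0, y => (y 0).getD 0
  | t + 1, y => (y (Fin.last (t + 1))).getD
      (lam • A (predictor lam A t fun i => y i.castSucc))

lemma norm_sub_predictor_le (lam : ℝ) (A : Euc n ≃ₗᵢ[ℝ] Euc n) {T K d : ℕ}
    (h : T < (K + 1) * d) {a : ℝ} {ν : ℕ → Euc n} (hν : ν ∈ Noise n T fun _ => a)
    {t : ℕ} (ht : t < T) :
    ‖srcX lam A ν t - predictor lam A t
      (fun i => chOut lam A (periodicTx lam A h).U ν i)‖ ≤ silentError lam a ((t + 1) % d) := by
  induction t with
  | zero =>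
    by_cases hd : d ∣ 0 + 1
    · rw [Nat.mod_eq_zero_of_dvd hd]
      simp [predictor, chOut, periodicTx, silentError, Nat.dvd_one.1 (by simpa using hd)]
    · have hd1 : d ≠ 1 := by rintro rfl; simp at hd
      have hd0 : d ≠ 0 := by rintro rfl; simp at h
      rw [Nat.mod_eq_of_lt (by omega)]
      simpa [predictor, chOut, periodicTx, silentError, hd1, srcX] using hν 0 ht
  | succ t ih =>
    by_cases hd : d ∣ t + 1 + 1
    · rw [Nat.mod_eq_zero_of_dvd hd]
      simp [predictor, chOut, periodicTx, silentError, hd]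
    · have hmod : (t + 1 + 1) % d = (t + 1) % d + 1 := by
        have hd0 : 0 < d := Nat.pos_of_ne_zero (by rintro rfl; simp at h)
        have hlt := Nat.mod_lt (t + 1) hd0
        have hdm := Nat.div_add_mod (t + 1) d
        have hne : (t + 1) % d + 1 ≠ d := fun he => hd ⟨(t + 1) / d + 1, by rw [mul_add]; omega⟩
        rw [← Nat.mod_add_mod]
        exact Nat.mod_eq_of_lt (by omega)
      have hX : predictor lam A (t + 1)
          (fun i => chOut lam A (periodicTx lam A h).U ν i) =
          lam • A (predictor lam A t fun i => chOut lam A (periodicTx lam A h).U ν i) := by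
        simp [predictor, chOut, periodicTx, hd]
      rw [hX, srcX, hmod, silentError_succ, add_sub_right_comm, ← smul_sub, ← map_sub]
      refine (norm_add_le _ _).trans (add_le_add ?_ (hν _ ht))
      rw [norm_smul, Real.norm_eq_abs, A.norm_map]
      exact mul_le_mul_of_nonneg_left (ih (by omega)) (abs_nonneg _)

lemma Jcost_periodicTx_le (lam : ℝ) (A : Euc n ≃ₗᵢ[ℝ] Euc n) {T K d : ℕ}
    (h : T < (K + 1) * d) {a : ℝ} (ha : 0 ≤ a) :
    Jcost lam A T K (fun _ => a) (periodicTx lam A h) (predictor lam A) ≤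
      ENNReal.ofReal (silentError lam a (d - 1)) := by
  have hd : 0 < d := Nat.pos_of_ne_zero (by rintro rfl; simp at h)
  refine iSup₂_le fun ν hν => iSup_le fun t => ENNReal.ofReal_le_ofReal ?_
  refine (norm_sub_predictor_le lam A h hν t.2).trans (silentError_mono lam ha ?_)
  exact Nat.le_sub_one_of_lt (Nat.mod_lt _ hd)

/-- A unit-vector orbit along which the noiseless dynamics acts as multiplication by `|λ|`. -/
def alignedDir (lam : ℝ) (A : Euc n ≃ₗᵢ[ℝ] Euc n) (v : Euc n) : ℕ → Euc n
  | 0 => v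
  | i + 1 => (if 0 ≤ lam then (1 : ℝ) else -1) • A (alignedDir lam A v i)

lemma norm_alignedDir (lam : ℝ) (A : Euc n ≃ₗᵢ[ℝ] Euc n) (v : Euc n) (i : ℕ) :
    ‖alignedDir lam A v i‖ = ‖v‖ := by
  induction i with
  | zero => rfl
  | succ i ih => rw [alignedDir]; split_ifs <;> simp [ih]

lemma smul_map_alignedDir (lam : ℝ) (A : Euc n ≃ₗᵢ[ℝ] Euc n) (v : Euc n) (i : ℕ) :
    lam • A (alignedDir lam A v i) = |lam| • alignedDir lam A v (i + 1) := by
  rw [alignedDir]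
  split_ifs with h
  · rw [abs_of_nonneg h, one_smul]
  · rw [abs_of_neg (not_le.1 h), smul_smul]; simp

/-- The noise `ν` before time `s`, followed by the noise `c • alignedDir` from time `s` on. -/
def pushedNoise (lam : ℝ) (A : Euc n ≃ₗᵢ[ℝ] Euc n) (v : Euc n) (ν : ℕ → Euc n) (s : ℕ)
    (c : ℝ) (t : ℕ) : Euc n :=
  if t < s then ν t else c • alignedDir lam A v (t - s)

lemma pushedNoise_mem (lam : ℝ) (A : Euc n ≃ₗᵢ[ℝ] Euc n) {v : Euc n} (hv : ‖v‖ = 1)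
    {ν : ℕ → Euc n} {T : ℕ} {a c : ℝ} (hν : ν ∈ Noise n T fun _ => a) (s : ℕ) (hc : |c| ≤ a) :
    pushedNoise lam A v ν s c ∈ Noise n T fun _ => a := by
  intro t ht
  rw [pushedNoise]
  split_ifs
  · exact hν t ht
  · simpa [norm_smul, norm_alignedDir, hv] using hc

lemma srcX_congr (lam : ℝ) (A : Euc n ≃ₗᵢ[ℝ] Euc n) {ν ν' : ℕ → Euc n} {t : ℕ}
    (h : ∀ i ≤ t, ν i = ν' i) : srcX lam A ν t = srcX lam A ν' t := by
  induction t with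
  | zero => exact h 0 le_rfl
  | succ t ih => rw [srcX, srcX, ih fun i hi => h i (by omega), h _ le_rfl]

lemma srcX_pushedNoise_of_lt (lam : ℝ) (A : Euc n ≃ₗᵢ[ℝ] Euc n) (v : Euc n) (ν : ℕ → Euc n)
    {s t : ℕ} (c : ℝ) (h : t < s) :
    srcX lam A (pushedNoise lam A v ν s c) t = srcX lam A ν t :=
  srcX_congr lam A fun _ hi => if_pos (hi.trans_lt h)

lemma srcX_pushedNoise_sub (lam : ℝ) (A : Euc n ≃ₗᵢ[ℝ] Euc n) (v : Euc n) (ν : ℕ → Euc n)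
    (s : ℕ) (c : ℝ) (i : ℕ) :
    srcX lam A (pushedNoise lam A v ν s c) (s + i) -
      srcX lam A (pushedNoise lam A v ν s (-c)) (s + i) =
      (2 * silentError lam c (i + 1)) • alignedDir lam A v i := by
  induction i with
  | zero =>
    cases s with
    | zero =>
      simp only [srcX, pushedNoise, silentError, Nat.not_lt_zero, if_false, Nat.sub_self,
        zero_add, Finset.sum_range_one, pow_zero, alignedDir]
      module
    | succ s =>
      rw [add_zero, srcX, srcX, srcX_pushedNoise_of_lt _ _ _ _ _ (Nat.lt_succ_self s),
        srcX_pushedNoise_of_lt _ _ _ _ _ (Nat.lt_succ_self s)]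
      simp only [pushedNoise, silentError, lt_irrefl, if_false, Nat.sub_self,
        zero_add, Finset.sum_range_one, pow_zero, alignedDir]
      module
  | succ i ih =>
    have hp (c : ℝ) : pushedNoise lam A v ν s c (s + i + 1) = c • alignedDir lam A v (i + 1) := by
      rw [pushedNoise, if_neg (by omega)]
      congr 2
      omega
    rw [← add_assoc, srcX, srcX, hp, hp, add_sub_add_comm, ← smul_sub, ← map_sub, ih, map_smul,
      smul_comm, smul_map_alignedDir, silentError_succ lam c (i + 1)]
    module

/-- The number of transmissions before time `s`. -/
def txCount {lam : ℝ} {A : Euc n ≃ₗᵢ[ℝ] Euc n} {T K : ℕ} (f : TxStrategy lam A T K)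
    (ν : ℕ → Euc n) (s : ℕ) : ℕ := ∑ i ∈ Finset.range s, (if f.U ν i then 1 else 0)

lemma txCount_le {lam : ℝ} {A : Euc n ≃ₗᵢ[ℝ] Euc n} {T K : ℕ} (f : TxStrategy lam A T K)
    (ν : ℕ → Euc n) {s : ℕ} (hs : s ≤ T) : txCount f ν s ≤ K := by
  induction s with
  | zero => simp [txCount]
  | succ s ih =>
    rw [txCount, Finset.sum_range_succ]
    split_ifs with hU
    · exact f.energy_ok ν s hs hU
    · exact ih (by omega)

/-- As long as the cost is smaller than `silentError lam a m`, an adversary can force one more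
transmission in each window of length `m`. -/
lemma exists_le_txCount {lam : ℝ} {A : Euc n ≃ₗᵢ[ℝ] Euc n} {T K : ℕ} (f : TxStrategy lam A T K)
    (g : EstStrategy n) {v : Euc n} (hv : ‖v‖ = 1) {a : ℝ} (ha : 0 ≤ a) {m : ℕ} (hm : 0 < m)
    (hJ : Jcost lam A T K (fun _ => a) f g < ENNReal.ofReal (silentError lam a m))
    (k : ℕ) (hk : k * m ≤ T) :
    ∃ ν ∈ Noise n T fun _ => a, ∃ s ≤ k * m, k ≤ txCount f ν s := by
  induction k with
  | zero => exact ⟨0, fun t _ => by simpa using ha, 0, by simp, by simp⟩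
  | succ k ih =>
    rw [Nat.succ_mul] at hk
    obtain ⟨ν, hν, s, hs, hcount⟩ := ih (by omega)
    have hmem (c : ℝ) (hc : |c| = a) : pushedNoise lam A v ν s c ∈ Noise n T fun _ => a :=
      pushedNoise_mem lam A hv hν s hc.le
    have hbefore (c : ℝ) {t : ℕ} (ht : t < s) : f.U (pushedNoise lam A v ν s c) t = f.U ν t :=
      f.adapted _ _ t (by omega) fun i hi => srcX_pushedNoise_of_lt lam A v ν c (by omega)
    have hstep (c : ℝ) (hc : |c| = a) {t : ℕ} (hst : s ≤ t) (ht : t < s + m)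
        (hU : f.U (pushedNoise lam A v ν s c) t = true) :
        ∃ ν ∈ Noise n T fun _ => a, ∃ s ≤ (k + 1) * m, k + 1 ≤ txCount f ν s := by
      refine ⟨_, hmem c hc, t + 1, by rw [Nat.succ_mul]; omega, ?_⟩
      rw [txCount, Finset.sum_range_succ, hU]
      refine Nat.succ_le_succ (hcount.trans ?_)
      calc txCount f ν s = txCount f (pushedNoise lam A v ν s c) s :=
            Finset.sum_congr rfl fun i hi => by rw [hbefore c (Finset.mem_range.1 hi)]
        _ ≤ _ := Finset.sum_le_sum_of_subset (Finset.range_subset_range.2 hst)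
    by_contra hno
    have hsilent (c : ℝ) (hc : |c| = a) {t : ℕ} (hst : s ≤ t) (ht : t < s + m) :
        chOut lam A f.U (pushedNoise lam A v ν s c) t = none :=
      if_neg fun hU => hno (hstep c hc hst ht hU)
    obtain ⟨i, rfl⟩ : ∃ i, m = i + 1 := ⟨m - 1, by omega⟩
    have hneg : |-a| = a := by rw [abs_neg, abs_of_nonneg ha]
    have hpos : |a| = a := abs_of_nonneg ha
    have hout : (fun j : Fin (s + i + 1) => chOut lam A f.U (pushedNoise lam A v ν s a) j) =
        fun j : Fin (s + i + 1) => chOut lam A f.U (pushedNoise lam A v ν s (-a)) j := by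
      funext j
      rcases lt_or_ge (j : ℕ) s with hj | hj
      · simp only [chOut, hbefore _ hj, srcX_pushedNoise_of_lt lam A v ν _ hj]
      · rw [hsilent a hpos hj (by omega), hsilent (-a) hneg hj (by omega)]
    have herr (c : ℝ) (hc : |c| = a) :
        ‖srcX lam A (pushedNoise lam A v ν s c) (s + i) -
          g (s + i) (fun j => chOut lam A f.U (pushedNoise lam A v ν s c) j)‖ <
          silentError lam a (i + 1) := by
      refine (ENNReal.ofReal_lt_ofReal_iff_of_nonneg (norm_nonneg _)).1 (lt_of_le_of_lt ?_ hJ)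
      exact le_iSup₂_of_le _ (hmem c hc) (le_iSup_of_le ⟨s + i, by omega⟩ le_rfl)
    have hp := herr a hpos
    have hn := herr (-a) hneg
    rw [hout] at hp
    have htri := norm_sub_le_norm_sub_add_norm_sub
      (srcX lam A (pushedNoise lam A v ν s a) (s + i))
      (g (s + i) (fun j => chOut lam A f.U (pushedNoise lam A v ν s (-a)) j))
      (srcX lam A (pushedNoise lam A v ν s (-a)) (s + i))
    rw [srcX_pushedNoise_sub, norm_smul, norm_alignedDir, hv, mul_one, Real.norm_eq_abs,
      norm_sub_rev (g _ _)] at htri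
    have := le_abs_self (2 * silentError lam a (i + 1))
    linarith

lemma ofReal_silentError_le_Jcost (hn : 1 ≤ n) {lam : ℝ} {A : Euc n ≃ₗᵢ[ℝ] Euc n} {T K m : ℕ}
    (hm : (K + 1) * m ≤ T) {a : ℝ} (ha : 0 ≤ a) (f : TxStrategy lam A T K) (g : EstStrategy n) :
    ENNReal.ofReal (silentError lam a m) ≤ Jcost lam A T K (fun _ => a) f g := by
  rcases Nat.eq_zero_or_pos m with rfl | hm0
  · simp [silentError_zero]
  by_contra! hJ
  have hv : ‖EuclideanSpace.single (⟨0, hn⟩ : Fin n) (1 : ℝ)‖ = 1 := by simp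
  obtain ⟨ν, -, s, hs, hcount⟩ := exists_le_txCount f g hv ha hm0 hJ (K + 1) hm
  have := txCount_le f ν (hs.trans hm)
  omega

lemma iInf_Jcost (hn : 1 ≤ n) (lam : ℝ) (A : Euc n ≃ₗᵢ[ℝ] Euc n) (T K : ℕ)
    {a : ℝ} (ha : 0 ≤ a) :
    (⨅ (f : TxStrategy lam A T K) (g : EstStrategy n), Jcost lam A T K (fun _ => a) f g) =
      ENNReal.ofReal (silentError lam a (DeltaOf T K - 1)) :=
  le_antisymm
    (iInf₂_le_of_le _ _ (Jcost_periodicTx_le lam A (lt_mul_DeltaOf T K) ha))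
    (le_iInf₂ fun f g => ofReal_silentError_le_Jcost hn (mul_DeltaOf_sub_one_le T K) ha f g)

/-- under homogeneous noise radii `a_t = a ≥ 0`, the optimal cost
of the remote estimation problem equals `a (|λ|^{Δ−1} − 1)/(|λ| − 1)` when
`|λ| ≠ 1`, and `(Δ − 1) a` when `|λ| = 1`, where `Δ = ⌈(T+1)/(K+1)⌉`. -/
theorem stmt17 {n : ℕ} (hn : 1 ≤ n) (lam : ℝ) (A : Euc n ≃ₗᵢ[ℝ] Euc n)
    (T K : ℕ) (hT : 1 ≤ T) (hK : 1 ≤ K) (hKT : K < T)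
    (a0 : ℝ) (ha0 : 0 ≤ a0) :
    (|lam| ≠ 1 →
      (⨅ (f : TxStrategy lam A T K) (g : EstStrategy n),
          Jcost lam A T K (fun _ => a0) f g) =
        ENNReal.ofReal (a0 * (|lam| ^ (DeltaOf T K - 1) - 1) / (|lam| - 1))) ∧
    (|lam| = 1 →
      (⨅ (f : TxStrategy lam A T K) (g : EstStrategy n),
          Jcost lam A T K (fun _ => a0) f g) =
        ENNReal.ofReal (((DeltaOf T K - 1 : ℕ) : ℝ) * a0)) := by
  rw [iInf_Jcost hn lam A T K ha0, silentError]
  refine ⟨fun h => ?_, fun h => ?_⟩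
  · rw [geom_sum_eq h, mul_div_assoc]
  · simp [h, mul_comm]
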